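/- arXiv:2501.15621 — 2 statements merged into one kernel-verified Lean document; each statement's English description precedes it below -/
import Mathlib

section
/- Let u₁, u₂, u₄ ∈ ℝ with u₄ < u₂ < u₁ and u₁ + 2u₂ + u₄ = 0, and set u₃ := u₂. Define c := −(u₁u₂ + u₁u₃ + u₁u₄ + u₂u₃ + u₂u₄ + u₃u₄), b := (u₁u₂u₃ + u₁u₂u₄ + u₁u₃u₄ + u₂u₃u₄)/2, d := −u₁u₂u₃u₄, and ν := (1/2)√((u₁−u₂)(u₂−u₄)). Then the function U(x) := u₄ + (u₁−u₄)(u₂−u₄) tanh²(νx) / ((u₁−u₂) + (u₂−u₄) tanh²(νx)) is well defined (the denominator is positive) and differentiable on ℝ, and satisfies the first-order invariant (U'(x))² + U(x)⁴ − c U(x)² − 2b U(x) = d for all x ∈ ℝ. -/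
theorem Real.hasDerivAt_tanh_one_sub_sq (x : ℝ) :
    HasDerivAt Real.tanh (1 - Real.tanh x ^ 2) x := by
  have hc : Real.cosh x ≠ 0 := (Real.cosh_pos x).ne'
  have h := (Real.hasDerivAt_sinh x).div (Real.hasDerivAt_cosh x) hc
  have hfun : Real.tanh = Real.sinh / Real.cosh := by
    ext y
    exact Real.tanh_eq_sinh_div_cosh y
  rw [Real.tanh_eq_sinh_div_cosh x, hfun]
  refine h.congr_deriv ?_
  field_simp

/-- The second hyperbolic (solitary-wave) degenerate waveform (coalescing roots
`u₃ = u₂`) satisfies the first-order invariant `(U')² + U⁴ - cU² - 2bU = d`. -/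
theorem mkdv_second_hyperbolic_waveform_invariant
    (u₁ u₂ u₃ u₄ c b d ν : ℝ)
    (h42 : u₄ < u₂) (h21 : u₂ < u₁)
    (h3 : u₃ = u₂)
    (hsum : u₁ + 2 * u₂ + u₄ = 0)
    (hc : c = -(u₁*u₂ + u₁*u₃ + u₁*u₄ + u₂*u₃ + u₂*u₄ + u₃*u₄))
    (hb : b = (u₁*u₂*u₃ + u₁*u₂*u₄ + u₁*u₃*u₄ + u₂*u₃*u₄) / 2)
    (hd : d = -(u₁*u₂*u₃*u₄))
    (hν : ν = (1/2) * Real.sqrt ((u₁ - u₂) * (u₂ - u₄)))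
    (U : ℝ → ℝ)
    (hU : ∀ x : ℝ, U x = u₄ + (u₁ - u₄) * (u₂ - u₄) * (Real.tanh (ν * x))^2 /
      ((u₁ - u₂) + (u₂ - u₄) * (Real.tanh (ν * x))^2)) :
    (∀ x : ℝ, 0 < (u₁ - u₂) + (u₂ - u₄) * (Real.tanh (ν * x))^2) ∧
    Differentiable ℝ U ∧
    ∀ x : ℝ, (deriv U x)^2 + (U x)^4 - c * (U x)^2 - 2 * b * U x = d := by
  have hA : 0 < u₁ - u₂ := sub_pos.2 h21
  have hB : 0 < u₂ - u₄ := sub_pos.2 h42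
  have hD : ∀ x : ℝ, 0 < (u₁ - u₂) + (u₂ - u₄) * (Real.tanh (ν * x))^2 := fun x => by
    positivity
  have hν2 : 4 * ν ^ 2 = (u₁ - u₂) * (u₂ - u₄) := by
    rw [hν, mul_pow, Real.sq_sqrt (mul_pos hA hB).le]
    ring
  have hder : ∀ x : ℝ, HasDerivAt U
      (2 * ν * (u₁ - u₄) * (u₂ - u₄) * (u₁ - u₂) * Real.tanh (ν * x) *
        (1 - Real.tanh (ν * x) ^ 2) /
        ((u₁ - u₂) + (u₂ - u₄) * (Real.tanh (ν * x))^2) ^ 2) x := fun x => by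
    have ht : HasDerivAt (fun y => Real.tanh (ν * y) ^ 2)
        (2 * Real.tanh (ν * x) * ((1 - Real.tanh (ν * x) ^ 2) * ν)) x := by
      have h := ((Real.hasDerivAt_tanh_one_sub_sq (ν * x)).comp x
        ((hasDerivAt_id x).const_mul ν)).pow 2
      exact h.congr_deriv (by simp)
    have h := ((ht.const_mul ((u₁ - u₄) * (u₂ - u₄))).div
      ((ht.const_mul (u₂ - u₄)).const_add (u₁ - u₂)) (hD x).ne').const_add u₄
    rw [funext hU]
    refine h.congr_deriv ?_
    congr 1
    ring
  refine ⟨hD, fun x => (hder x).differentiableAt, fun x => ?_⟩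
  have hfactor : (U x) ^ 4 - c * (U x) ^ 2 - 2 * b * U x - d =
      (U x - u₁) * (U x - u₂) ^ 2 * (U x - u₄) := by
    rw [hc, hb, hd, h3]
    linear_combination (U x) ^ 3 * hsum
  have hDx := (hD x).ne'
  have hU₁ : U x - u₁ = -((u₁ - u₄) * (u₁ - u₂)) /
      ((u₁ - u₂) + (u₂ - u₄) * (Real.tanh (ν * x))^2) := by
    rw [hU]
    field_simp
    ring
  have hU₂ : U x - u₂ = -((u₁ - u₂) * (u₂ - u₄) * (1 - Real.tanh (ν * x) ^ 2)) /
      ((u₁ - u₂) + (u₂ - u₄) * (Real.tanh (ν * x))^2) := by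
    rw [hU]
    field_simp
    ring
  have hU₄ : U x - u₄ = (u₁ - u₄) * (u₂ - u₄) * (Real.tanh (ν * x))^2 /
      ((u₁ - u₂) + (u₂ - u₄) * (Real.tanh (ν * x))^2) := by
    rw [hU]
    ring
  have hderiv : (deriv U x) ^ 2 = -((U x - u₁) * (U x - u₂) ^ 2 * (U x - u₄)) := by
    rw [(hder x).deriv, hU₁, hU₂, hU₄]
    generalize (u₁ - u₂) + (u₂ - u₄) * (Real.tanh (ν * x))^2 = D at hDx ⊢
    generalize Real.tanh (ν * x) = t
    linear_combination ((u₁ - u₄) * (u₂ - u₄) * (u₁ - u₂) * t * (1 - t ^ 2)) ^ 2 / D ^ 4 * hν2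
  linear_combination hderiv + hfactor
end

section
/- Let λ₁ ∈ ℝ with λ₁ ≠ 0, and let λ₂ ∈ ℂ with λ₂ ≠ 0 and Im λ₂ > 0. Define P(λ) := 16(λ² − λ₁²)(λ² − λ₂²)(λ² − conj(λ₂)²) for λ ∈ ℂ, and let S₀ ⊂ ℂ be the union of the imaginary axis {λ ∈ ℂ : Re λ = 0} and the real segment [−|λ₁|, |λ₁|] (regarded as a subset of ℂ). Then {Λ ∈ ℂ : ∃ λ ∈ S₀, Λ² = 4P(λ)} = {Λ ∈ ℂ : Re Λ = 0}, the imaginary axis. -/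
/-- For real `s`, the product `(s - w) (s - conj w)` is the real number `(s - Re w)² + (Im w)²`. -/
lemma ofReal_sub_mul_ofReal_sub_conj (s : ℝ) (w : ℂ) :
    ((s : ℂ) - w) * ((s : ℂ) - (starRingEnd ℂ) w) = (((s - w.re) ^ 2 + w.im ^ 2 : ℝ) : ℂ) := by
  apply Complex.ext
  · simp only [Complex.mul_re, Complex.sub_re, Complex.sub_im, Complex.conj_re, Complex.conj_im,
      Complex.ofReal_re, Complex.ofReal_im]
    ring
  · simp only [Complex.mul_im, Complex.sub_re, Complex.sub_im, Complex.conj_re, Complex.conj_im,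
      Complex.ofReal_re, Complex.ofReal_im]
    ring

/-- A complex number whose square is a nonpositive real is purely imaginary. -/
lemma Complex.re_eq_zero_of_sq_eq_ofReal_nonpos {z : ℂ} {r : ℝ} (hr : r ≤ 0)
    (h : z ^ 2 = (r : ℂ)) : z.re = 0 := by
  have hre := congrArg Complex.re h
  have him := congrArg Complex.im h
  simp only [pow_two, Complex.mul_re, Complex.mul_im, Complex.ofReal_re,
    Complex.ofReal_im] at hre him
  by_contra hz
  have him0 : z.im = 0 := by
    have : z.re * z.im = 0 := by linarith
    exact (mul_eq_zero.mp this).resolve_left hz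
  rw [him0] at hre
  have := mul_self_pos.mpr hz
  linarith

/-- The squares of the points of `iℝ ∪ [-|a|, |a|]` are exactly the reals at most `a²`. -/
lemma exists_mem_imaginary_union_segment_sq_eq {a s : ℝ} (hs : s ≤ a ^ 2) :
    ∃ l ∈ {l : ℂ | l.re = 0} ∪ (fun x : ℝ => (x : ℂ)) '' Set.Icc (-|a|) |a|,
      l ^ 2 = (s : ℂ) := by
  rcases le_total 0 s with h | h
  · refine ⟨(√s : ℂ), Or.inr ⟨√s,
      ⟨?_, (Real.sqrt_le_sqrt hs).trans_eq (Real.sqrt_sq_eq_abs a)⟩, rfl⟩, ?_⟩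
    · linarith [Real.sqrt_nonneg s, abs_nonneg a]
    · rw [← Complex.ofReal_pow, Real.sq_sqrt h]
  · refine ⟨(√(-s) : ℂ) * Complex.I, Or.inl (by simp), ?_⟩
    rw [mul_pow, Complex.I_sq, ← Complex.ofReal_pow, Real.sq_sqrt (by linarith)]
    simp

/-- The square of a point of `iℝ ∪ [-|a|, |a|]` is a real at most `a²`. -/
lemma exists_sq_eq_ofReal_of_mem_imaginary_union_segment {a : ℝ} {l : ℂ}
    (hl : l ∈ {l : ℂ | l.re = 0} ∪ (fun x : ℝ => (x : ℂ)) '' Set.Icc (-|a|) |a|) :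
    ∃ s ≤ a ^ 2, l ^ 2 = (s : ℂ) := by
  rcases hl with hl | ⟨x, hx, rfl⟩
  · refine ⟨-l.im ^ 2, by nlinarith [sq_nonneg l.im, sq_nonneg a], ?_⟩
    have hl' : l.re = 0 := hl
    apply Complex.ext <;> simp [pow_two, hl']
  · exact ⟨x ^ 2, sq_le_sq.mpr (abs_le.mpr hx), by simp⟩

/-- The cubic `64 (s - a) ((s - p)² + q²)` attains every nonpositive value on `s ≤ a`. -/
lemma exists_le_cubic_eq_neg_sq (a p q y : ℝ) :
    ∃ s ≤ a, 64 * (s - a) * ((s - p) ^ 2 + q ^ 2) = -y ^ 2 := by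
  set m := min a p - 1 - y ^ 2 with hm
  have hma : m - a ≤ -(1 + y ^ 2) := by linarith [min_le_left a p]
  have hmp : m - p ≤ -1 := by linarith [min_le_right a p, sq_nonneg y]
  have hle : m ≤ a := by linarith [sq_nonneg y]
  have hcont : ContinuousOn (fun s : ℝ => 64 * (s - a) * ((s - p) ^ 2 + q ^ 2))
      (Set.Icc m a) := by fun_prop
  have hlow : 64 * (m - a) * ((m - p) ^ 2 + q ^ 2) ≤ -y ^ 2 := by
    have h1 : 1 ≤ (m - p) ^ 2 + q ^ 2 := by nlinarith [sq_nonneg q]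
    nlinarith [sq_nonneg y]
  obtain ⟨s, hs, hval⟩ := intermediate_value_Icc hle hcont
    (show -y ^ 2 ∈ _ from ⟨hlow, by simpa using sq_nonneg y⟩)
  exact ⟨s, hs.2, hval⟩


/-- First part of Theorem 2 of the paper (cnoidal-type waveform): the image of
`S₀ = iℝ ∪ [-|λ₁|, |λ₁|]` under `Λ = ±2√P(λ)` (i.e. the set of `Λ` with
`Λ² = 4P(λ)` for some `λ ∈ S₀`), where
`P(λ) = 16(λ²-λ₁²)(λ²-λ₂²)(λ²-conj(λ₂)²)`, is exactly the imaginary axis. -/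
theorem mkdv_cnoidal_stability_spectrum_imaginary_part
    (lam₁ : ℝ) (h₁ : lam₁ ≠ 0)
    (lam₂ : ℂ) (h₂ : lam₂ ≠ 0) (him : 0 < lam₂.im)
    (P : ℂ → ℂ)
    (hP : ∀ l : ℂ, P l = 16*(l^2 - (lam₁:ℂ)^2)*(l^2 - lam₂^2)*(l^2 - ((starRingEnd ℂ) lam₂)^2))
    (S₀ : Set ℂ)
    (hS₀ : S₀ = {l : ℂ | l.re = 0}
        ∪ (fun x : ℝ => (x : ℂ)) '' Set.Icc (-|lam₁|) |lam₁|) :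
    {Λ : ℂ | ∃ l ∈ S₀, Λ^2 = 4 * P l} = {Λ : ℂ | Λ.re = 0} := by
  subst hS₀
  have key : ∀ (l : ℂ) (s : ℝ), l ^ 2 = (s : ℂ) → 4 * P l =
      ((64 * (s - lam₁ ^ 2) * ((s - (lam₂ ^ 2).re) ^ 2 + (lam₂ ^ 2).im ^ 2) : ℝ) : ℂ) := by
    intro l s hl
    rw [Complex.ofReal_mul, ← ofReal_sub_mul_ofReal_sub_conj, hP, hl, map_pow]
    push_cast
    ring
  ext Λ
  constructor
  · rintro ⟨l, hl, hΛ⟩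
    obtain ⟨s, hs, hls⟩ := exists_sq_eq_ofReal_of_mem_imaginary_union_segment hl
    rw [key l s hls] at hΛ
    refine Complex.re_eq_zero_of_sq_eq_ofReal_nonpos ?_ hΛ
    exact mul_nonpos_of_nonpos_of_nonneg (by linarith) (by positivity)
  · intro hΛ
    have hre : Λ.re = 0 := hΛ
    obtain ⟨s, hs, hval⟩ :=
      exists_le_cubic_eq_neg_sq (lam₁ ^ 2) (lam₂ ^ 2).re (lam₂ ^ 2).im Λ.im
    obtain ⟨l, hl, hls⟩ := exists_mem_imaginary_union_segment_sq_eq hs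
    refine ⟨l, hl, ?_⟩
    rw [key l s hls, hval]
    apply Complex.ext <;> simp [pow_two, hre]
end
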